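/- [Product form on product matrices] Let p, q ≥ 1. For any Y₁ ∈ M_n and Y₂ ∈ M_m, ‖Y₁ ⊗ Y₂‖_{NC:p,q} = ‖Y₁‖_q · ‖Y₂‖_p. -/

import Mathlib

open scoped Kronecker
open Matrix
open scoped ENNReal NNReal ComplexOrder

noncomputable section

open scoped Classical in
/-- The Schatten `p`-norm of a complex square matrix, `p ∈ [1,∞]` (as an `ℝ≥0∞`).
For finite `p` it equals `(Tr |A|^p)^{1/p}`, computed via the eigenvalues of `Aᴴ * A`;
for `p = ∞` it is the operator norm (largest singular value). -/
noncomputable def schattenNorm {k : Type*} [Fintype k] [DecidableEq k] (p : ℝ≥0∞)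
    (A : Matrix k k ℂ) : ℝ :=
  if p = ⊤ then
    ⨆ i, Real.sqrt ((Matrix.posSemidef_conjTranspose_mul_self A).isHermitian.eigenvalues i)
  else
    (∑ i, (Matrix.posSemidef_conjTranspose_mul_self A).isHermitian.eigenvalues i
        ^ (p.toReal / 2)) ^ (1 / p.toReal)

/-- `r` defined by `1/r = max{1/p, 1/q} - min{1/p, 1/q}` (so `r = ∞` when `p = q`). -/
noncomputable def ncR (p q : ℝ≥0∞) : ℝ≥0∞ := (max p⁻¹ q⁻¹ - min p⁻¹ q⁻¹)⁻¹

/-- The non-commutative `L^q(L^p)` norm (supremum form, used when `p ≤ q`):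
`sup_{A,B} ‖(A ⊗ I) Y (B ⊗ I)‖_p / (‖A‖_{2r} ‖B‖_{2r})`. -/
noncomputable def ncNormSup {k l : Type*} [Fintype k] [DecidableEq k] [Fintype l] [DecidableEq l]
    (p q : ℝ≥0∞) (Y : Matrix (k × l) (k × l) ℂ) : ℝ :=
  ⨆ A : Matrix k k ℂ, ⨆ B : Matrix k k ℂ,
    schattenNorm p ((A ⊗ₖ (1 : Matrix l l ℂ)) * Y * (B ⊗ₖ (1 : Matrix l l ℂ))) /
      (schattenNorm (2 * ncR p q) A * schattenNorm (2 * ncR p q) B)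

/-- The non-commutative `L^q(L^p)` norm (infimum form, used when `q ≤ p`):
`inf { ∑ᵢ ‖Aᵢ‖_{2r} ‖Bᵢ‖_{2r} ‖Zᵢ‖_p : Y = ∑ᵢ (Aᵢ ⊗ I) Zᵢ (Bᵢ ⊗ I) }`. -/
noncomputable def ncNormInf {k l : Type*} [Fintype k] [DecidableEq k] [Fintype l] [DecidableEq l]
    (p q : ℝ≥0∞) (Y : Matrix (k × l) (k × l) ℂ) : ℝ :=
  sInf { s : ℝ | ∃ (N : ℕ) (A B : Fin N → Matrix k k ℂ)
      (Z : Fin N → Matrix (k × l) (k × l) ℂ),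
    Y = ∑ i, (A i ⊗ₖ (1 : Matrix l l ℂ)) * Z i * (B i ⊗ₖ (1 : Matrix l l ℂ)) ∧
    s = ∑ i, schattenNorm (2 * ncR p q) (A i) * schattenNorm (2 * ncR p q) (B i) *
          schattenNorm p (Z i) }

open scoped Classical in
/-- The non-commutative `L^q(L^p)` norm `‖·‖_{NC:p,q}`. -/
noncomputable def ncNorm {k l : Type*} [Fintype k] [DecidableEq k] [Fintype l] [DecidableEq l]
    (p q : ℝ≥0∞) (Y : Matrix (k × l) (k × l) ℂ) : ℝ :=
  if p ≤ q then ncNormSup p q Y else ncNormInf p q Y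

open scoped Classical in
/-- Real power of a Hermitian matrix via the spectral decomposition (junk value `0` on
non-Hermitian matrices). -/
noncomputable def mrpow {k : Type*} [Fintype k] [DecidableEq k] (A : Matrix k k ℂ) (e : ℝ) :
    Matrix k k ℂ :=
  if hA : A.IsHermitian then
    (hA.eigenvectorUnitary : Matrix k k ℂ) *
      Matrix.diagonal (fun i => ((hA.eigenvalues i ^ e : ℝ) : ℂ)) *
      ((hA.eigenvectorUnitary : Matrix k k ℂ))ᴴ
  else 0

/-- Partial trace over the second (inside) factor. -/
noncomputable def ptrace2 {k l : Type*} [Fintype l]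
    (Y : Matrix (k × l) (k × l) ℂ) : Matrix k k ℂ :=
  fun i i' => ∑ j : l, Y (i, j) (i', j)

/-- The Carlen–Lieb quantity `Ψ_{p,q}(Y) = (Tr₁ (Tr₂ Y^p)^{q/p})^{1/q}`. -/
noncomputable def Psi {k l : Type*} [Fintype k] [DecidableEq k] [Fintype l] [DecidableEq l]
    (p q : ℝ) (Y : Matrix (k × l) (k × l) ℂ) : ℝ :=
  (Matrix.trace (mrpow (ptrace2 (mrpow Y p)) (q / p))).re ^ (1 / q)

/-- The quantity `|||X|||_{p,q} = inf {Ψ_{p,q}(A) + Ψ_{p,q}(B) : X + A = B, A ≥ 0, B ≥ 0}`,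
for `X` on the space `M_k ⊗ (M_l ⊗ M_2)`. -/
noncomputable def tripleNorm {k l : Type*} [Fintype k] [DecidableEq k] [Fintype l] [DecidableEq l]
    (p q : ℝ) (X : Matrix (k × (l × Fin 2)) (k × (l × Fin 2)) ℂ) : ℝ :=
  sInf { s : ℝ | ∃ A B : Matrix (k × (l × Fin 2)) (k × (l × Fin 2)) ℂ,
    A.PosSemidef ∧ B.PosSemidef ∧ X + A = B ∧ s = Psi p q A + Psi p q B }

/-- The block matrix `[[0, Y],[Yᴴ, 0]]`, viewed in `M_k ⊗ (M_l ⊗ M_2)`. -/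
noncomputable def clBlock {k l : Type*} (Y : Matrix (k × l) (k × l) ℂ) :
    Matrix (k × (l × Fin 2)) (k × (l × Fin 2)) ℂ :=
  fun x y =>
    if x.2.2 = 0 ∧ y.2.2 = 1 then Y (x.1, x.2.1) (y.1, y.2.1)
    else if x.2.2 = 1 ∧ y.2.2 = 0 then star (Y (y.1, y.2.1) (x.1, x.2.1))
    else 0

/-- The block-diagonal matrix `diag(P, Q) = [[P, 0],[0, Q]]`, viewed in `M_k ⊗ (M_l ⊗ M_2)`. -/
noncomputable def blockDiag2 {k l : Type*} (P Q : Matrix (k × l) (k × l) ℂ) :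
    Matrix (k × (l × Fin 2)) (k × (l × Fin 2)) ℂ :=
  fun x y =>
    if x.2.2 = 0 ∧ y.2.2 = 0 then P (x.1, x.2.1) (y.1, y.2.1)
    else if x.2.2 = 1 ∧ y.2.2 = 1 then Q (x.1, x.2.1) (y.1, y.2.1)
    else 0

/-- The Carlen–Lieb norm `‖Y‖_{CL} = (1/2) ||| [[0,Y],[Yᴴ,0]] |||_{p,q}`. -/
noncomputable def clNorm {k l : Type*} [Fintype k] [DecidableEq k] [Fintype l] [DecidableEq l]
    (p q : ℝ) (Y : Matrix (k × l) (k × l) ℂ) : ℝ :=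
  (1 / 2) * tripleNorm p q (clBlock Y)

end

/-- A matrix with orthogonal columns of lengths `s i` is a unitary matrix times `diagonal s`. -/
theorem exists_unitary_mul_diagonal {k : Type*} [Fintype k] [DecidableEq k]
    (M : Matrix k k ℂ) (s : k → ℝ)
    (h : Mᴴ * M = diagonal (fun i => ((s i ^ 2 : ℝ) : ℂ))) :
    ∃ U ∈ unitaryGroup k ℂ, M = U * diagonal (fun i => (s i : ℂ)) := by
  have hcol : ∀ i j, ∑ a, star (M a i) * M a j = if i = j then ((s i ^ 2 : ℝ) : ℂ) else 0 := by
    intro i j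
    have := congrFun (congrFun h i) j
    simpa [mul_apply, diagonal_apply] using this
  let v : k → EuclideanSpace ℂ k := fun i => WithLp.toLp 2 (fun a => ((s i : ℂ))⁻¹ * M a i)
  have hv : Orthonormal ℂ (Set.domRestrict {i | s i ≠ 0} v) := by
    rw [orthonormal_iff_ite]
    rintro ⟨i, hi⟩ ⟨j, hj⟩
    have hi' : (s i : ℂ) ≠ 0 := by exact_mod_cast hi
    have : inner ℂ (v i) (v j) = (s i : ℂ)⁻¹ * (s j : ℂ)⁻¹ * ∑ a, star (M a i) * M a j := by
      rw [Finset.mul_sum, PiLp.inner_apply]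
      refine Finset.sum_congr rfl fun a _ => ?_
      simp [v]
      ring
    simp only [Set.domRestrict_apply, Subtype.mk.injEq]
    rw [this, hcol]
    split_ifs with hij
    · subst hij
      push_cast
      field_simp
    · simp
  obtain ⟨b, hb⟩ := hv.exists_orthonormalBasis_extension_of_card_eq (by simp)
  refine ⟨(EuclideanSpace.basisFun k ℂ).toBasis.toMatrix b,
    (EuclideanSpace.basisFun k ℂ).toMatrix_orthonormalBasis_mem_unitary b, ?_⟩
  ext a i
  rw [mul_diagonal]
  by_cases hi : s i = 0
  · have h0 := hcol i i
    simp only [hi] at h0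
    have h1 : ∑ a, ‖M a i‖ ^ 2 = 0 := by
      have : ((∑ a, ‖M a i‖ ^ 2 : ℝ) : ℂ) = 0 := by
        push_cast
        simpa [Complex.conj_mul'] using h0
      exact_mod_cast this
    rw [Finset.sum_eq_zero_iff_of_nonneg (fun _ _ => by positivity)] at h1
    simpa [hi] using h1 a (Finset.mem_univ _)
  · have hi' : (s i : ℂ) ≠ 0 := by exact_mod_cast hi
    have : b i = v i := hb i hi
    simp only [Module.Basis.toMatrix_apply, this]
    simp [v]
    field_simp

/-- Singular value decomposition of a complex square matrix. -/
theorem exists_svd {k : Type*} [Fintype k] [DecidableEq k] (A : Matrix k k ℂ) :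
    ∃ U ∈ unitaryGroup k ℂ, ∃ V ∈ unitaryGroup k ℂ, ∃ s : k → ℝ, (∀ i, 0 ≤ s i) ∧
      A = U * diagonal (fun i => (s i : ℂ)) * V := by
  have hP := posSemidef_conjTranspose_mul_self A
  have hH := hP.isHermitian
  set W : Matrix k k ℂ := hH.eigenvectorUnitary.1
  have hWu : W ∈ unitaryGroup k ℂ := hH.eigenvectorUnitary.2
  have h1 : star W * W = 1 := mem_unitaryGroup_iff'.mp hWu
  have h2 : W * star W = 1 := mem_unitaryGroup_iff.mp hWu
  obtain ⟨l, hl, hspec⟩ : ∃ l : k → ℝ, (∀ i, 0 ≤ l i) ∧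
      Aᴴ * A = W * diagonal (fun i => (l i : ℂ)) * star W :=
    ⟨hH.eigenvalues, hP.eigenvalues_nonneg, by
      simpa [Unitary.conjStarAlgAut_apply, Function.comp_def] using! hH.spectral_theorem⟩
  obtain ⟨U, hU, hUA⟩ := exists_unitary_mul_diagonal (A * W) (fun i => Real.sqrt (l i)) (by
    simp only [Real.sq_sqrt (hl _)]
    rw [conjTranspose_mul, ← star_eq_conjTranspose W,
      show star W * Aᴴ * (A * W) = star W * (Aᴴ * A) * W by simp only [mul_assoc], hspec,
      show star W * (W * diagonal (fun i => (l i : ℂ)) * star W) * W =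
        (star W * W) * diagonal (fun i => (l i : ℂ)) * (star W * W) by simp only [mul_assoc],
      h1, one_mul, mul_one])
  refine ⟨U, hU, star W, Unitary.star_mem hWu, fun i => Real.sqrt (l i), fun i => Real.sqrt_nonneg _, ?_⟩
  rw [← hUA, mul_assoc, h2, mul_one]

/-- The `ℓ^p` norm of a real vector with nonnegative entries. -/
noncomputable def vecNorm {k : Type*} [Fintype k] (p : ℝ≥0∞) (s : k → ℝ) : ℝ :=
  open scoped Classical in
  if p = ⊤ then ⨆ i, s i else (∑ i, s i ^ p.toReal) ^ (1 / p.toReal)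

theorem schattenNorm_svd {k : Type*} [Fintype k] [DecidableEq k] (p : ℝ≥0∞)
    {U V : Matrix k k ℂ} (hU : U ∈ unitaryGroup k ℂ) (hV : V ∈ unitaryGroup k ℂ)
    {s : k → ℝ} (hs : ∀ i, 0 ≤ s i) :
    schattenNorm p (U * diagonal (fun i => (s i : ℂ)) * V) = vecNorm p s := by
  set A := U * diagonal (fun i => (s i : ℂ)) * V with hA
  have hH := (posSemidef_conjTranspose_mul_self A).isHermitian
  have h1 : star U * U = 1 := mem_unitaryGroup_iff'.mp hU
  have h2 : V * star V = 1 := mem_unitaryGroup_iff.mp hV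
  have hAA : Aᴴ * A = star V * (diagonal (fun i => ((s i ^ 2 : ℝ) : ℂ)) * V) := by
    rw [hA, conjTranspose_mul, conjTranspose_mul, ← star_eq_conjTranspose U,
      ← star_eq_conjTranspose V, diagonal_conjTranspose]
    rw [show star V * (diagonal (star fun i => (s i : ℂ)) * star U) *
      (U * diagonal (fun i => (s i : ℂ)) * V) = star V * (diagonal (star fun i => (s i : ℂ)) *
        (star U * U) * diagonal (fun i => (s i : ℂ)) * V) by simp only [mul_assoc], h1]
    rw [mul_one, diagonal_mul_diagonal]
    congr 3
    ext i
    simp [sq]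
  have hchar : (Aᴴ * A).charpoly = ∏ i, (Polynomial.X - Polynomial.C ((s i ^ 2 : ℝ) : ℂ)) := by
    rw [hAA, charpoly_mul_comm, mul_assoc, h2, mul_one, charpoly_diagonal]
  have hroots : Multiset.map (fun i => (s i ^ 2)) Finset.univ.val =
      Multiset.map hH.eigenvalues Finset.univ.val := by
    have h3 := hH.roots_charpoly_eq_eigenvalues
    rw [hchar, Polynomial.roots_prod _ _
      (Finset.prod_ne_zero_iff.mpr fun i _ => Polynomial.X_sub_C_ne_zero _)] at h3
    simp only [Polynomial.roots_X_sub_C, Multiset.bind_singleton] at h3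
    have := congrArg (Multiset.map Complex.re) h3
    simpa [Multiset.map_map, Function.comp_def, ← Complex.ofReal_pow] using this
  have hcomp : ∀ f : ℝ → ℝ, Multiset.map (fun i => f (s i ^ 2)) Finset.univ.val =
      Multiset.map (fun i => f (hH.eigenvalues i)) Finset.univ.val := by
    intro f
    simpa [Multiset.map_map, Function.comp_def] using congrArg (Multiset.map f) hroots
  unfold schattenNorm vecNorm
  split_ifs with hp
  · have h := hcomp Real.sqrt
    simp only [Real.sqrt_sq (hs _)] at h
    have : Set.range (fun i => Real.sqrt (hH.eigenvalues i)) = Set.range s := by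
      ext x
      simpa using (congrArg (x ∈ ·) h).symm
    simp only [iSup, this]
  · have h := congrArg Multiset.sum (hcomp (fun x => x ^ (p.toReal / 2)))
    congr 1
    refine Eq.trans h.symm ?_
    refine Finset.sum_congr rfl fun i _ => ?_
    rw [← Real.rpow_natCast, ← Real.rpow_mul (hs i)]
    congr 1
    push_cast
    ring

theorem vecNorm_top {k : Type*} [Fintype k] (s : k → ℝ) : vecNorm ⊤ s = ⨆ i, s i := by
  simp [vecNorm]

theorem vecNorm_of_ne_top {k : Type*} [Fintype k] {p : ℝ≥0∞} (hp : p ≠ ⊤) (s : k → ℝ) :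
    vecNorm p s = (∑ i, s i ^ p.toReal) ^ (1 / p.toReal) := by
  simp [vecNorm, hp]

theorem vecNorm_nonneg {k : Type*} [Fintype k] (p : ℝ≥0∞) {s : k → ℝ} (hs : ∀ i, 0 ≤ s i) :
    0 ≤ vecNorm p s := by
  by_cases hp : p = ⊤
  · subst hp
    rw [vecNorm_top]
    exact Real.iSup_nonneg hs
  · rw [vecNorm_of_ne_top hp]
    exact Real.rpow_nonneg (Finset.sum_nonneg fun i _ => Real.rpow_nonneg (hs i) _) _

/-- For finite `p`, a nonnegative vector is its norm times the `1/p`-th power of a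
subprobability vector. -/
theorem exists_eq_vecNorm_mul_rpow {k : Type*} [Fintype k] {p : ℝ≥0∞} (hp : p ≠ ⊤) (hp0 : p ≠ 0)
    {s : k → ℝ} (hs : ∀ i, 0 ≤ s i) :
    ∃ α : k → ℝ, (∀ i, 0 ≤ α i) ∧ ∑ i, α i ≤ 1 ∧ vecNorm p s * ∑ i, α i = vecNorm p s ∧
      ∀ i, s i = vecNorm p s * α i ^ (p⁻¹).toReal := by
  have hpr : 0 < p.toReal := ENNReal.toReal_pos hp0 hp
  set N := vecNorm p s with hN
  have hN0 : 0 ≤ N := vecNorm_nonneg p hs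
  have hsum0 : 0 ≤ ∑ i, s i ^ p.toReal :=
    Finset.sum_nonneg fun i _ => Real.rpow_nonneg (hs i) _
  have hNp : N ^ p.toReal = ∑ i, s i ^ p.toReal := by
    rw [hN, vecNorm_of_ne_top hp, ← Real.rpow_mul hsum0, one_div_mul_cancel hpr.ne', Real.rpow_one]
  rcases hN0.eq_or_lt with h0 | hpos
  · refine ⟨0, by simp, by simp, by simp [← h0], fun i => ?_⟩
    rw [← h0, Real.zero_rpow hpr.ne'] at hNp
    have := (Finset.sum_eq_zero_iff_of_nonneg
      (fun i _ => Real.rpow_nonneg (hs i) _)).mp hNp.symm i (Finset.mem_univ _)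
    rw [Real.rpow_eq_zero (hs i) hpr.ne'] at this
    simp [← h0, this]
  · have hsum1 : ∑ i, (s i / N) ^ p.toReal = 1 := by
      simp_rw [Real.div_rpow (hs _) hN0]
      rw [← Finset.sum_div, ← hNp, div_self (Real.rpow_pos_of_pos hpos _).ne']
    refine ⟨fun i => (s i / N) ^ p.toReal, fun i => Real.rpow_nonneg (div_nonneg (hs i) hN0) _,
      hsum1.le, by rw [hsum1, mul_one], fun i => ?_⟩
    rw [← Real.rpow_mul (div_nonneg (hs i) hN0), ENNReal.toReal_inv, mul_inv_cancel₀ hpr.ne',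
      Real.rpow_one, mul_div_cancel₀ _ hpos.ne']

theorem exists_le_vecNorm_mul_rpow {k : Type*} [Fintype k] {p : ℝ≥0∞} (hp0 : p ≠ 0)
    {s : k → ℝ} (hs : ∀ i, 0 ≤ s i) :
    ∃ α : k → ℝ, (∀ i, 0 ≤ α i) ∧ ∑ i, α i ≤ 1 ∧
      ∀ i, s i ≤ vecNorm p s * α i ^ (p⁻¹).toReal := by
  by_cases hp : p = ⊤
  · subst hp
    refine ⟨0, by simp, by simp, fun i => ?_⟩
    simpa [vecNorm_top] using le_ciSup (Set.finite_range s).bddAbove i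
  · obtain ⟨α, h1, h2, -, h3⟩ := exists_eq_vecNorm_mul_rpow hp hp0 hs
    exact ⟨α, h1, h2, fun i => (h3 i).le⟩

theorem vecNorm_le_of_le_mul_rpow {k : Type*} [Fintype k] {p : ℝ≥0∞} (hp0 : p ≠ 0)
    {s α : k → ℝ} {c : ℝ} (hs : ∀ i, 0 ≤ s i) (hα : ∀ i, 0 ≤ α i) (hα1 : ∑ i, α i ≤ 1)
    (hc : 0 ≤ c) (h : ∀ i, s i ≤ c * α i ^ (p⁻¹).toReal) : vecNorm p s ≤ c := by
  by_cases hp : p = ⊤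
  · subst hp
    rw [vecNorm_top]
    exact Real.iSup_le (fun i => by simpa using h i) hc
  · have hpr : 0 < p.toReal := ENNReal.toReal_pos hp0 hp
    rw [vecNorm_of_ne_top hp, one_div, Real.rpow_inv_le_iff_of_pos
      (Finset.sum_nonneg fun i _ => Real.rpow_nonneg (hs i) _) hc hpr]
    calc ∑ i, s i ^ p.toReal ≤ ∑ i, c ^ p.toReal * α i := by
          refine Finset.sum_le_sum fun i _ => ?_
          refine (Real.rpow_le_rpow (hs i) (h i) hpr.le).trans_eq ?_
          rw [Real.mul_rpow hc (Real.rpow_nonneg (hα i) _), ← Real.rpow_mul (hα i),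
            ENNReal.toReal_inv, inv_mul_cancel₀ hpr.ne', Real.rpow_one]
      _ = c ^ p.toReal * ∑ i, α i := by rw [Finset.mul_sum]
      _ ≤ c ^ p.toReal := mul_le_of_le_one_right (Real.rpow_nonneg hc _) hα1

/-- The `ℓ^p` norm is attained by pairing with a power of a subprobability vector. -/
theorem exists_vecNorm_eq_sum {k : Type*} [Fintype k] {p : ℝ≥0∞} (hp : 1 ≤ p)
    {s : k → ℝ} (hs : ∀ i, 0 ≤ s i) :
    ∃ α : k → ℝ, (∀ i, 0 ≤ α i) ∧ ∑ i, α i ≤ 1 ∧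
      ∑ i, α i ^ (1 - (p⁻¹).toReal) * s i = vecNorm p s := by
  have hp0 : p ≠ 0 := (zero_lt_one.trans_le hp).ne'
  by_cases hpt : p = ⊤
  · subst hpt
    rw [vecNorm_top]
    rcases isEmpty_or_nonempty k with hk | hk
    · exact ⟨0, by simp, by simp, by simp⟩
    · obtain ⟨j, hj⟩ := exists_eq_ciSup_of_finite (f := s)
      classical
      refine ⟨Pi.single j 1, fun i => ?_, by simp, by simp [Pi.single_apply, hj]⟩
      by_cases h : i = j <;> simp [h]
  · obtain ⟨α, h1, h2, h3, h4⟩ := exists_eq_vecNorm_mul_rpow hpt hp0 hs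
    refine ⟨α, h1, h2, ?_⟩
    have hx : (p⁻¹).toReal ≤ 1 := ENNReal.toReal_le_of_le_ofReal zero_le_one (by simpa using hp)
    calc ∑ i, α i ^ (1 - (p⁻¹).toReal) * s i = ∑ i, vecNorm p s * α i := by
          refine Finset.sum_congr rfl fun i _ => ?_
          conv_lhs => rw [h4 i]
          rw [mul_left_comm, ← Real.rpow_add_of_nonneg (h1 i) (by linarith) ENNReal.toReal_nonneg,
            sub_add_cancel, Real.rpow_one]
      _ = vecNorm p s := by rw [← Finset.mul_sum, h3]

theorem vecNorm_mul {k l : Type*} [Fintype k] [Fintype l] (p : ℝ≥0∞) {s : k → ℝ} {t : l → ℝ}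
    (hs : ∀ i, 0 ≤ s i) (ht : ∀ j, 0 ≤ t j) :
    vecNorm p (fun x : k × l => s x.1 * t x.2) = vecNorm p s * vecNorm p t := by
  by_cases hp : p = ⊤
  · subst hp
    simp only [vecNorm_top]
    rw [Real.iSup_mul_of_nonneg (Real.iSup_nonneg ht)]
    simp_rw [Real.mul_iSup_of_nonneg (hs _)]
    rcases isEmpty_or_nonempty k with hk | hk
    · simp
    rcases isEmpty_or_nonempty l with hl | hl
    · simp
    exact ciSup_prod (Set.finite_range _).bddAbove
  · simp only [vecNorm_of_ne_top hp]
    rw [← Real.mul_rpow (Finset.sum_nonneg fun i _ => Real.rpow_nonneg (hs i) _)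
      (Finset.sum_nonneg fun i _ => Real.rpow_nonneg (ht i) _), Finset.sum_mul_sum,
      Fintype.sum_prod_type]
    simp_rw [Real.mul_rpow (hs _) (ht _)]

theorem sum_norm_sq_row_eq {k : Type*} [Fintype k] {A B : Matrix k k ℂ}
    (h : A * Aᴴ = B * Bᴴ) (i : k) : ∑ j, ‖A i j‖ ^ 2 = ∑ j, ‖B i j‖ ^ 2 := by
  have := congrFun (congrFun h i) i
  simp only [mul_apply, conjTranspose_apply, RCLike.star_def, Complex.mul_conj'] at this
  exact_mod_cast this

theorem sum_norm_sq_row_of_mem_unitaryGroup {k : Type*} [Fintype k] [DecidableEq k]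
    {U : Matrix k k ℂ} (hU : U ∈ unitaryGroup k ℂ) (i : k) : ∑ j, ‖U i j‖ ^ 2 = 1 := by
  rw [sum_norm_sq_row_eq (B := 1) (by simpa [star_eq_conjTranspose] using mem_unitaryGroup_iff.mp hU)]
  rw [Finset.sum_eq_single i] <;> simp +contextual [one_apply, eq_comm]

theorem sum_norm_sq_col_of_mem_unitaryGroup {k : Type*} [Fintype k] [DecidableEq k]
    {U : Matrix k k ℂ} (hU : U ∈ unitaryGroup k ℂ) (j : k) : ∑ i, ‖U i j‖ ^ 2 = 1 := by
  simpa using sum_norm_sq_row_of_mem_unitaryGroup (Unitary.star_mem hU) j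

theorem sum_rpow_mul_row_le {k : Type*} [Fintype k] [DecidableEq k]
    {U V : Matrix k k ℂ} (hU : U ∈ unitaryGroup k ℂ) (hV : V ∈ unitaryGroup k ℂ)
    {σ α γ : k → ℝ} (hσ : ∀ i, 0 ≤ σ i) (hα : ∀ i, 0 ≤ α i) (hα1 : ∑ i, α i ≤ 1)
    (hγ : ∀ i, 0 ≤ γ i) (hγ1 : ∑ i, γ i ≤ 1) {c t z : ℝ} (ht : 0 ≤ t) (hz : 0 ≤ z)
    (htz : t + 2 * z = 1) (h : ∀ i, σ i ≤ c * γ i ^ z) :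
    ∑ i, α i ^ t * ∑ j, ‖(U * diagonal (fun i => (σ i : ℂ)) * V) i j‖ ^ 2 ≤ c ^ 2 := by
  have hrow : ∀ i, ∑ j, ‖(U * diagonal (fun i => (σ i : ℂ)) * V) i j‖ ^ 2 =
      ∑ j, ‖U i j‖ ^ 2 * σ j ^ 2 := by
    intro i
    rw [sum_norm_sq_row_eq (B := U * diagonal (fun i => (σ i : ℂ)))]
    · simp [mul_diagonal, mul_pow]
    · rw [conjTranspose_mul, mul_assoc, ← mul_assoc V, ← star_eq_conjTranspose V,
        mem_unitaryGroup_iff.mp hV, one_mul]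
  have hyoung : ∀ i j, α i ^ t * σ j ^ 2 ≤ c ^ 2 * (t * α i + 2 * z * γ j) := by
    intro i j
    have h1 : σ j ^ 2 ≤ c ^ 2 * γ j ^ (2 * z) := by
      refine (pow_le_pow_left₀ (hσ j) (h j) 2).trans_eq ?_
      rw [mul_pow, ← Real.rpow_natCast (γ j ^ z), ← Real.rpow_mul (hγ j)]
      norm_num [mul_comm]
    calc α i ^ t * σ j ^ 2 ≤ α i ^ t * (c ^ 2 * γ j ^ (2 * z)) :=
          mul_le_mul_of_nonneg_left h1 (Real.rpow_nonneg (hα i) _)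
      _ = c ^ 2 * (α i ^ t * γ j ^ (2 * z)) := by ring
      _ ≤ _ := mul_le_mul_of_nonneg_left (Real.geom_mean_le_arith_mean2_weighted ht (by linarith)
          (hα i) (hγ j) htz) (sq_nonneg c)
  calc ∑ i, α i ^ t * ∑ j, ‖(U * diagonal (fun i => (σ i : ℂ)) * V) i j‖ ^ 2
      = ∑ i, ∑ j, ‖U i j‖ ^ 2 * (α i ^ t * σ j ^ 2) := by
        simp_rw [hrow, Finset.mul_sum]
        refine Finset.sum_congr rfl fun i _ => Finset.sum_congr rfl fun j _ => by ring
    _ ≤ ∑ i, ∑ j, ‖U i j‖ ^ 2 * (c ^ 2 * (t * α i + 2 * z * γ j)) :=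
        Finset.sum_le_sum fun i _ => Finset.sum_le_sum fun j _ =>
          mul_le_mul_of_nonneg_left (hyoung i j) (by positivity)
    _ = c ^ 2 * (t * ∑ i, α i * ∑ j, ‖U i j‖ ^ 2 + 2 * z * ∑ j, γ j * ∑ i, ‖U i j‖ ^ 2) := by
        simp only [Finset.mul_sum, mul_add, Finset.sum_add_distrib]
        congr 1
        · refine Finset.sum_congr rfl fun i _ => Finset.sum_congr rfl fun j _ => by ring
        · rw [Finset.sum_comm]
          refine Finset.sum_congr rfl fun i _ => Finset.sum_congr rfl fun j _ => by ring
    _ = c ^ 2 * (t * ∑ i, α i + 2 * z * ∑ j, γ j) := by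
        simp_rw [sum_norm_sq_row_of_mem_unitaryGroup hU, sum_norm_sq_col_of_mem_unitaryGroup hU,
          mul_one]
    _ ≤ c ^ 2 * 1 := by
        refine mul_le_mul_of_nonneg_left ?_ (sq_nonneg c)
        rw [← htz]
        exact add_le_add (mul_le_of_le_one_right ht hα1)
          (mul_le_of_le_one_right (by linarith) hγ1)
    _ = c ^ 2 := mul_one _

theorem sum_mul_mul_norm_sq_le {k : Type*} [Fintype k] [DecidableEq k]
    {U V : Matrix k k ℂ} (hU : U ∈ unitaryGroup k ℂ) (hV : V ∈ unitaryGroup k ℂ)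
    {w y σ : k → ℝ} (hw : ∀ i, 0 ≤ w i) (hy : ∀ i, 0 ≤ y i) (hσ : ∀ i, 0 ≤ σ i)
    {a b d : ℝ≥0∞} (ha : a ≠ 0) (hb : b ≠ 0) (hd : d ≠ 0)
    (habd : (a⁻¹).toReal + (d⁻¹).toReal + 2 * (b⁻¹).toReal = 1) :
    ∑ i, ∑ j, w i * y j * ‖(U * diagonal (fun i => (σ i : ℂ)) * V) i j‖ ^ 2 ≤
      vecNorm a w * vecNorm d y * vecNorm b σ ^ 2 := by
  obtain ⟨α, hα, hα1, hwα⟩ := exists_le_vecNorm_mul_rpow ha hw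
  obtain ⟨β, hβ, hβ1, hyβ⟩ := exists_le_vecNorm_mul_rpow hd hy
  obtain ⟨γ, hγ, hγ1, hσγ⟩ := exists_le_vecNorm_mul_rpow hb hσ
  have hx0 : 0 ≤ (a⁻¹).toReal := ENNReal.toReal_nonneg
  have hd0 : 0 ≤ (d⁻¹).toReal := ENNReal.toReal_nonneg
  have hz0 : 0 ≤ (b⁻¹).toReal := ENNReal.toReal_nonneg
  set x := (a⁻¹).toReal
  set u := (d⁻¹).toReal
  set z := (b⁻¹).toReal
  have hNw := vecNorm_nonneg a hw
  have hNy := vecNorm_nonneg d hy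
  set A := U * diagonal (fun i => (σ i : ℂ)) * V with hA
  obtain ⟨t, ht, lam, hl, mu, hm, hlm, hx, hu⟩ : ∃ t : ℝ, 0 ≤ t ∧ ∃ lam : ℝ, 0 ≤ lam ∧
      ∃ mu : ℝ, 0 ≤ mu ∧ lam + mu = 1 ∧ x = t * lam ∧ u = t * mu := by
    rcases (add_nonneg hx0 hd0).eq_or_lt with h0 | h0
    · exact ⟨0, le_rfl, 1, zero_le_one, 0, le_rfl, by simp, by linarith, by linarith⟩
    · exact ⟨x + u, h0.le, x / (x + u), by positivity, u / (x + u), by positivity,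
        by field_simp, by field_simp, by field_simp⟩
  have htz : t + 2 * z = 1 := by
    rw [← habd, hx, hu, ← mul_add, hlm, mul_one]
  have hyoung : ∀ i j, w i * y j ≤
      vecNorm a w * vecNorm d y * (lam * α i ^ t + mu * β j ^ t) := by
    intro i j
    calc w i * y j ≤ (vecNorm a w * α i ^ x) * (vecNorm d y * β j ^ u) :=
          mul_le_mul (hwα i) (hyβ j) (hy j) ((hw i).trans (hwα i))
      _ = vecNorm a w * vecNorm d y * ((α i ^ t) ^ lam * (β j ^ t) ^ mu) := by
          rw [hx, hu, Real.rpow_mul (hα i), Real.rpow_mul (hβ j)]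
          ring
      _ ≤ _ := mul_le_mul_of_nonneg_left (Real.geom_mean_le_arith_mean2_weighted hl hm
          (Real.rpow_nonneg (hα i) _) (Real.rpow_nonneg (hβ j) _) hlm) (mul_nonneg hNw hNy)
  have hrow : ∑ i, α i ^ t * ∑ j, ‖A i j‖ ^ 2 ≤ vecNorm b σ ^ 2 :=
    sum_rpow_mul_row_le hU hV hσ hα hα1 hγ hγ1 ht hz0 htz hσγ
  have hcol : ∑ j, β j ^ t * ∑ i, ‖A i j‖ ^ 2 ≤ vecNorm b σ ^ 2 := by
    have hAs : star A = star V * diagonal (fun i => (σ i : ℂ)) * star U := by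
      simp only [hA, star_eq_conjTranspose, conjTranspose_mul, diagonal_conjTranspose, mul_assoc]
      congr 3
      ext i
      simp
    have := sum_rpow_mul_row_le (Unitary.star_mem hV) (Unitary.star_mem hU) hσ hβ hβ1 hγ hγ1
      ht hz0 htz hσγ
    rw [← hAs] at this
    simpa using this
  calc ∑ i, ∑ j, w i * y j * ‖A i j‖ ^ 2
      ≤ ∑ i, ∑ j, vecNorm a w * vecNorm d y * (lam * α i ^ t + mu * β j ^ t) * ‖A i j‖ ^ 2 :=
        Finset.sum_le_sum fun i _ => Finset.sum_le_sum fun j _ =>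
          mul_le_mul_of_nonneg_right (hyoung i j) (by positivity)
    _ = vecNorm a w * vecNorm d y * (lam * (∑ i, α i ^ t * ∑ j, ‖A i j‖ ^ 2) +
          mu * ∑ j, β j ^ t * ∑ i, ‖A i j‖ ^ 2) := by
        simp only [Finset.mul_sum, mul_add, add_mul, Finset.sum_add_distrib]
        congr 1
        · refine Finset.sum_congr rfl fun i _ => Finset.sum_congr rfl fun j _ => by ring
        · rw [Finset.sum_comm]
          refine Finset.sum_congr rfl fun i _ => Finset.sum_congr rfl fun j _ => by ring
    _ ≤ vecNorm a w * vecNorm d y * (lam * vecNorm b σ ^ 2 + mu * vecNorm b σ ^ 2) := by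
        gcongr
    _ = _ := by rw [← add_mul, hlm, one_mul]

theorem trace_diagonal_mul_mul_diagonal_mul {k : Type*} [Fintype k] [DecidableEq k]
    (w y : k → ℂ) (A B : Matrix k k ℂ) :
    trace (diagonal w * A * diagonal y * B) = ∑ i, ∑ j, w i * A i j * y j * B j i := by
  simp only [trace, diag_apply]
  refine Finset.sum_congr rfl fun i _ => ?_
  rw [mul_apply]
  simp [mul_diagonal, diagonal_mul]

/-- Hölder's inequality for the trace of a product of four matrices. -/
theorem norm_trace_mul_mul_mul_le {k : Type*} [Fintype k] [DecidableEq k]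
    {a b d : ℝ≥0∞} (ha : a ≠ 0) (hb : b ≠ 0) (hd : d ≠ 0)
    (habd : (a⁻¹).toReal + (d⁻¹).toReal + 2 * (b⁻¹).toReal = 1) (W A Y B : Matrix k k ℂ) :
    ‖trace (W * A * Y * B)‖ ≤
      schattenNorm a W * schattenNorm b A * schattenNorm d Y * schattenNorm b B := by
  obtain ⟨U₁, hU₁, V₁, hV₁, w, hw, rfl⟩ := exists_svd W
  obtain ⟨U₂, hU₂, V₂, hV₂, σ, hσ, rfl⟩ := exists_svd A
  obtain ⟨U₃, hU₃, V₃, hV₃, y, hy, rfl⟩ := exists_svd Y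
  obtain ⟨U₄, hU₄, V₄, hV₄, τ, hτ, rfl⟩ := exists_svd B
  rw [schattenNorm_svd _ hU₁ hV₁ hw, schattenNorm_svd _ hU₂ hV₂ hσ, schattenNorm_svd _ hU₃ hV₃ hy,
    schattenNorm_svd _ hU₄ hV₄ hτ]
  have hA := sum_mul_mul_norm_sq_le (mul_mem hV₁ hU₂) (mul_mem hV₂ hU₃) hw hy hσ ha hb hd habd
  have hB := sum_mul_mul_norm_sq_le (mul_mem hV₃ hU₄) (mul_mem hV₄ hU₁) hy hw hτ hd hb ha
    (by linarith)
  set A' := V₁ * U₂ * diagonal (fun i => (σ i : ℂ)) * (V₂ * U₃) with hA'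
  set B' := V₃ * U₄ * diagonal (fun i => (τ i : ℂ)) * (V₄ * U₁) with hB'
  have htr : trace (U₁ * diagonal (fun i => (w i : ℂ)) * V₁ *
      (U₂ * diagonal (fun i => (σ i : ℂ)) * V₂) * (U₃ * diagonal (fun i => (y i : ℂ)) * V₃) *
      (U₄ * diagonal (fun i => (τ i : ℂ)) * V₄)) =
      ∑ i, ∑ j, (w i : ℂ) * A' i j * y j * B' j i := by
    rw [← trace_diagonal_mul_mul_diagonal_mul, hA', hB']
    simp only [mul_assoc]
    rw [trace_mul_comm]
    simp only [mul_assoc]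
  have hNw := vecNorm_nonneg a hw
  have hNy := vecNorm_nonneg d hy
  have hNσ := vecNorm_nonneg b hσ
  have hNτ := vecNorm_nonneg b hτ
  rw [htr]
  calc ‖∑ i, ∑ j, (w i : ℂ) * A' i j * y j * B' j i‖
      ≤ ∑ i, ∑ j, w i * y j * (‖A' i j‖ * ‖B' j i‖) := by
        refine (norm_sum_le _ _).trans (Finset.sum_le_sum fun i _ =>
          (norm_sum_le _ _).trans_eq (Finset.sum_congr rfl fun j _ => ?_))
        simp only [norm_mul, Complex.norm_real, Real.norm_of_nonneg (hw i),
          Real.norm_of_nonneg (hy j)]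
        ring
    _ = ∑ x : k × k, (√(w x.1 * y x.2) * ‖A' x.1 x.2‖) * (√(w x.1 * y x.2) * ‖B' x.2 x.1‖) := by
        rw [Fintype.sum_prod_type]
        refine Finset.sum_congr rfl fun i _ => Finset.sum_congr rfl fun j _ => ?_
        rw [mul_mul_mul_comm (√_), Real.mul_self_sqrt (mul_nonneg (hw i) (hy j))]
    _ ≤ √(∑ x : k × k, (√(w x.1 * y x.2) * ‖A' x.1 x.2‖) ^ 2) *
          √(∑ x : k × k, (√(w x.1 * y x.2) * ‖B' x.2 x.1‖) ^ 2) :=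
        Real.sum_mul_le_sqrt_mul_sqrt _ _ _
    _ ≤ √(vecNorm a w * vecNorm d y * vecNorm b σ ^ 2) *
          √(vecNorm a w * vecNorm d y * vecNorm b τ ^ 2) := by
        simp_rw [mul_pow, Real.sq_sqrt (mul_nonneg (hw _) (hy _))]
        refine mul_le_mul (Real.sqrt_le_sqrt ?_) (Real.sqrt_le_sqrt ?_) (Real.sqrt_nonneg _)
          (Real.sqrt_nonneg _)
        · rwa [Fintype.sum_prod_type]
        · rw [Fintype.sum_prod_type_right, mul_comm (vecNorm a w)]
          simpa only [mul_comm (w _)] using hB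
    _ = _ := by
        rw [Real.sqrt_mul (mul_nonneg hNw hNy), Real.sqrt_mul (mul_nonneg hNw hNy),
          Real.sqrt_sq hNσ, Real.sqrt_sq hNτ, mul_mul_mul_comm,
          Real.mul_self_sqrt (mul_nonneg hNw hNy)]
        ring

theorem schattenNorm_nonneg {k : Type*} [Fintype k] [DecidableEq k] (p : ℝ≥0∞)
    (A : Matrix k k ℂ) : 0 ≤ schattenNorm p A := by
  obtain ⟨U, hU, V, hV, s, hs, rfl⟩ := exists_svd A
  rw [schattenNorm_svd p hU hV hs]
  exact vecNorm_nonneg p hs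

theorem schattenNorm_kronecker {k l : Type*} [Fintype k] [DecidableEq k] [Fintype l]
    [DecidableEq l] (p : ℝ≥0∞) (A : Matrix k k ℂ) (B : Matrix l l ℂ) :
    schattenNorm p (A ⊗ₖ B) = schattenNorm p A * schattenNorm p B := by
  obtain ⟨U, hU, V, hV, s, hs, rfl⟩ := exists_svd A
  obtain ⟨U', hU', V', hV', t, ht, rfl⟩ := exists_svd B
  rw [schattenNorm_svd p hU hV hs, schattenNorm_svd p hU' hV' ht, ← vecNorm_mul p hs ht,
    ← schattenNorm_svd p (kronecker_mem_unitary hU hU') (kronecker_mem_unitary hV hV')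
      (fun x => mul_nonneg (hs x.1) (ht x.2))]
  rw [mul_kronecker_mul, mul_kronecker_mul, diagonal_kronecker_diagonal]
  simp only [Complex.ofReal_mul]

theorem schattenNorm_le_of_le_mul_rpow {k : Type*} [Fintype k] [DecidableEq k] {p : ℝ≥0∞}
    (hp : p ≠ 0) {U V : Matrix k k ℂ} (hU : U ∈ unitaryGroup k ℂ) (hV : V ∈ unitaryGroup k ℂ)
    {s α : k → ℝ} {c : ℝ} (hs : ∀ i, 0 ≤ s i) (hα : ∀ i, 0 ≤ α i) (hα1 : ∑ i, α i ≤ 1)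
    (hc : 0 ≤ c) (h : ∀ i, s i ≤ c * α i ^ (p⁻¹).toReal) :
    schattenNorm p (U * diagonal (fun i => (s i : ℂ)) * V) ≤ c := by
  rw [schattenNorm_svd p hU hV hs]
  exact vecNorm_le_of_le_mul_rpow hp hs hα hα1 hc h

theorem schattenNorm_top_one_le {k : Type*} [Fintype k] [DecidableEq k] :
    schattenNorm ⊤ (1 : Matrix k k ℂ) ≤ 1 := by
  have := schattenNorm_le_of_le_mul_rpow (k := k) (p := ⊤) (s := 1) (α := 0) (c := 1) (by simp)
    (one_mem _) (one_mem _) (by simp) (by simp) (by simp) (by simp) (by simp)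
  simpa using this

theorem toReal_inv_le_one {p : ℝ≥0∞} (hp : 1 ≤ p) : (p⁻¹).toReal ≤ 1 :=
  ENNReal.toReal_le_of_le_ofReal zero_le_one (by simpa using hp)

theorem exists_dual_exponent {p : ℝ≥0∞} (hp : 1 ≤ p) :
    ∃ p' : ℝ≥0∞, 1 ≤ p' ∧ (p'⁻¹).toReal = 1 - (p⁻¹).toReal := by
  have h : p⁻¹ ≤ 1 := ENNReal.inv_le_one.mpr hp
  refine ⟨(1 - p⁻¹)⁻¹, ENNReal.one_le_inv.mpr tsub_le_self, ?_⟩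
  rw [inv_inv, ENNReal.toReal_sub_of_le h ENNReal.one_ne_top, ENNReal.toReal_one]

/-- The Schatten norm is attained by pairing with an element of the dual unit ball. -/
theorem exists_trace_mul_eq_schattenNorm {k : Type*} [Fintype k] [DecidableEq k] {p p' : ℝ≥0∞}
    (hp : 1 ≤ p) (hp' : 1 ≤ p') (hpp : (p'⁻¹).toReal = 1 - (p⁻¹).toReal) (X : Matrix k k ℂ) :
    ∃ W : Matrix k k ℂ, schattenNorm p' W ≤ 1 ∧ trace (W * X) = (schattenNorm p X : ℂ) := by
  obtain ⟨U, hU, V, hV, s, hs, rfl⟩ := exists_svd X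
  obtain ⟨α, hα, hα1, hαs⟩ := exists_vecNorm_eq_sum hp hs
  rw [schattenNorm_svd p hU hV hs]
  refine ⟨star V * diagonal (fun i => ((α i ^ (p'⁻¹).toReal : ℝ) : ℂ)) * star U,
    schattenNorm_le_of_le_mul_rpow (zero_lt_one.trans_le hp').ne' (Unitary.star_mem hV)
      (Unitary.star_mem hU) (fun i => Real.rpow_nonneg (hα i) _) hα hα1 zero_le_one
      (fun i => (one_mul _).ge), ?_⟩
  have h1 : star U * U = 1 := mem_unitaryGroup_iff'.mp hU
  have h2 : V * star V = 1 := mem_unitaryGroup_iff.mp hV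
  rw [mul_assoc, mul_assoc (star V), trace_mul_comm, mul_assoc, ← mul_assoc (star U),
    mul_assoc _ V, h2, mul_one, ← mul_assoc (star U), h1, one_mul, diagonal_mul_diagonal,
    trace_diagonal, ← hαs, hpp]
  push_cast
  rfl

theorem norm_trace_mul_le {k : Type*} [Fintype k] [DecidableEq k] {p p' : ℝ≥0∞}
    (hp : 1 ≤ p) (hp' : 1 ≤ p') (hpp : (p'⁻¹).toReal = 1 - (p⁻¹).toReal) (W X : Matrix k k ℂ) :
    ‖trace (W * X)‖ ≤ schattenNorm p' W * schattenNorm p X := by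
  have h := norm_trace_mul_mul_mul_le (a := p') (b := ⊤) (d := p)
    (zero_lt_one.trans_le hp').ne' (by simp) (zero_lt_one.trans_le hp).ne' (by simp [hpp]) W 1 X 1
  rw [mul_one, mul_one] at h
  have h1 := schattenNorm_top_one_le (k := k)
  have h0 := schattenNorm_nonneg ⊤ (1 : Matrix k k ℂ)
  have hW := schattenNorm_nonneg p' W
  have hX := schattenNorm_nonneg p X
  calc _ ≤ _ := h
    _ ≤ schattenNorm p' W * 1 * schattenNorm p X * 1 := by gcongr
    _ = _ := by ring

/-- Hölder's inequality for Schatten norms of a product of three matrices. -/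
theorem schattenNorm_mul_mul_le {k : Type*} [Fintype k] [DecidableEq k]
    {p b d : ℝ≥0∞} (hp : 1 ≤ p) (hb : b ≠ 0) (hd : d ≠ 0)
    (h : (p⁻¹).toReal = (d⁻¹).toReal + 2 * (b⁻¹).toReal) (A Y B : Matrix k k ℂ) :
    schattenNorm p (A * Y * B) ≤ schattenNorm b A * schattenNorm d Y * schattenNorm b B := by
  obtain ⟨p', hp', hpp⟩ := exists_dual_exponent hp
  obtain ⟨W, hW, hWX⟩ := exists_trace_mul_eq_schattenNorm hp hp' hpp (A * Y * B)
  have h1 := norm_trace_mul_mul_mul_le (zero_lt_one.trans_le hp').ne' hb hd (by linarith) W A Y B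
  rw [← mul_assoc, ← mul_assoc] at hWX
  rw [hWX, Complex.norm_real, Real.norm_of_nonneg (schattenNorm_nonneg _ _)] at h1
  have hA := schattenNorm_nonneg b A
  have hB := schattenNorm_nonneg b B
  have hY := schattenNorm_nonneg d Y
  calc _ ≤ _ := h1
    _ ≤ 1 * schattenNorm b A * schattenNorm d Y * schattenNorm b B := by gcongr
    _ = _ := by rw [one_mul]

theorem ncR_comm (p q : ℝ≥0∞) : ncR p q = ncR q p := by
  rw [ncR, ncR, max_comm, min_comm]

theorem ncR_ne_zero {p q : ℝ≥0∞} (hp : 1 ≤ p) (hq : 1 ≤ q) : 2 * ncR p q ≠ 0 := by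
  refine mul_ne_zero two_ne_zero (ENNReal.inv_ne_zero.mpr (ne_top_of_le_ne_top
    ENNReal.one_ne_top (tsub_le_self.trans (max_le ?_ ?_))))
  · exact ENNReal.inv_le_one.mpr hp
  · exact ENNReal.inv_le_one.mpr hq

theorem two_mul_toReal_inv_two_mul_ncR {p q : ℝ≥0∞} (hp : 1 ≤ p) (h : p ≤ q) :
    2 * ((2 * ncR p q)⁻¹).toReal = (p⁻¹).toReal - (q⁻¹).toReal := by
  have h1 : q⁻¹ ≤ p⁻¹ := ENNReal.inv_le_inv.mpr h
  have h2 : p⁻¹ ≠ ⊤ := ne_top_of_le_ne_top ENNReal.one_ne_top (ENNReal.inv_le_one.mpr hp)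
  rw [ENNReal.mul_inv (by simp) (by simp), ncR, max_eq_left h1, min_eq_right h1, inv_inv,
    ENNReal.toReal_mul, ENNReal.toReal_sub_of_le h1 h2]
  simp

theorem kronecker_one_mul_kronecker_mul {k l : Type*} [Fintype k] [Fintype l] [DecidableEq l]
    (A Y B : Matrix k k ℂ) (Z : Matrix l l ℂ) :
    (A ⊗ₖ (1 : Matrix l l ℂ)) * (Y ⊗ₖ Z) * (B ⊗ₖ (1 : Matrix l l ℂ)) = (A * Y * B) ⊗ₖ Z := by
  rw [← mul_kronecker_mul, ← mul_kronecker_mul, one_mul, mul_one]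

theorem exists_schattenNorm_le_schattenNorm_mul_mul {k : Type*} [Fintype k] [DecidableEq k]
    {p q b : ℝ≥0∞} (hp : 1 ≤ p) (hq : 1 ≤ q) (hb : b ≠ 0)
    (hpq : 2 * (b⁻¹).toReal = (p⁻¹).toReal - (q⁻¹).toReal) (Y : Matrix k k ℂ) :
    ∃ A B : Matrix k k ℂ, schattenNorm b A ≤ 1 ∧ schattenNorm b B ≤ 1 ∧
      schattenNorm q Y ≤ schattenNorm p (A * Y * B) := by
  obtain ⟨U, hU, V, hV, s, hs, rfl⟩ := exists_svd Y
  obtain ⟨α, hα, hα1, hαs⟩ := exists_vecNorm_eq_sum hq hs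
  obtain ⟨p', hp', hpp⟩ := exists_dual_exponent hp
  have hz0 : 0 ≤ (b⁻¹).toReal := ENNReal.toReal_nonneg
  set z := (b⁻¹).toReal with hz
  have hαz : ∀ i, 0 ≤ α i ^ z := fun i => Real.rpow_nonneg (hα i) _
  have h1 : star U * U = 1 := mem_unitaryGroup_iff'.mp hU
  have h2 : V * star V = 1 := mem_unitaryGroup_iff.mp hV
  refine ⟨1 * diagonal (fun i => ((α i ^ z : ℝ) : ℂ)) * star U,
    star V * diagonal (fun i => ((α i ^ z : ℝ) : ℂ)) * 1,
    schattenNorm_le_of_le_mul_rpow hb (one_mem _) (Unitary.star_mem hU) hαz hα hα1 zero_le_one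
      (fun i => (one_mul _).ge),
    schattenNorm_le_of_le_mul_rpow hb (Unitary.star_mem hV) (one_mem _) hαz hα hα1 zero_le_one
      (fun i => (one_mul _).ge), ?_⟩
  rw [schattenNorm_svd q hU hV hs, one_mul, mul_one,
    show diagonal (fun i => ((α i ^ z : ℝ) : ℂ)) * star U * (U * diagonal (fun i => (s i : ℂ)) * V) *
      (star V * diagonal (fun i => ((α i ^ z : ℝ) : ℂ))) =
      diagonal (fun i => ((α i ^ z : ℝ) : ℂ)) * ((star U * U) * diagonal (fun i => (s i : ℂ)) *
        (V * star V)) * diagonal (fun i => ((α i ^ z : ℝ) : ℂ)) by simp only [mul_assoc],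
    h1, h2, one_mul, mul_one, diagonal_mul_diagonal, diagonal_mul_diagonal]
  set X := diagonal (fun i => ((α i ^ z : ℝ) : ℂ) * s i * ((α i ^ z : ℝ) : ℂ)) with hX
  have hW : schattenNorm p' (1 * diagonal (fun i => ((α i ^ (p'⁻¹).toReal : ℝ) : ℂ)) * 1) ≤ 1 :=
    schattenNorm_le_of_le_mul_rpow (zero_lt_one.trans_le hp').ne' (one_mem _) (one_mem _)
      (fun i => Real.rpow_nonneg (hα i) _) hα hα1 zero_le_one (fun i => (one_mul _).ge)
  rw [one_mul, mul_one] at hW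
  have hle := norm_trace_mul_le hp hp' hpp
    (diagonal (fun i => ((α i ^ (p'⁻¹).toReal : ℝ) : ℂ))) X
  have htr : trace (diagonal (fun i => ((α i ^ (p'⁻¹).toReal : ℝ) : ℂ)) * X) =
      (vecNorm q s : ℂ) := by
    rw [hX, diagonal_mul_diagonal, trace_diagonal, ← hαs]
    push_cast
    refine Finset.sum_congr rfl fun i _ => ?_
    have : α i ^ (1 - (q⁻¹).toReal) = α i ^ (p'⁻¹).toReal * α i ^ z * α i ^ z := by
      rw [← Real.rpow_add_of_nonneg (hα i) ENNReal.toReal_nonneg hz0,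
        ← Real.rpow_add_of_nonneg (hα i) (add_nonneg ENNReal.toReal_nonneg hz0) hz0, hpp]
      congr 1
      linarith
    rw [this]
    push_cast
    ring
  rw [htr, Complex.norm_real, Real.norm_of_nonneg (vecNorm_nonneg q hs)] at hle
  exact hle.trans (mul_le_of_le_one_left (schattenNorm_nonneg p X) hW)

theorem exists_eq_mul_mul_schattenNorm_le {k : Type*} [Fintype k] [DecidableEq k]
    {p q b : ℝ≥0∞} (hp : 1 ≤ p) (hq : 1 ≤ q) (hb : b ≠ 0) (hle : q ≤ p)
    (hpq : 2 * (b⁻¹).toReal = (q⁻¹).toReal - (p⁻¹).toReal) (Y : Matrix k k ℂ) :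
    ∃ A X B : Matrix k k ℂ, Y = A * X * B ∧ schattenNorm b A ≤ 1 ∧ schattenNorm b B ≤ 1 ∧
      schattenNorm p X ≤ schattenNorm q Y := by
  have hp0 : p ≠ 0 := (zero_lt_one.trans_le hp).ne'
  have hq0 : q ≠ 0 := (zero_lt_one.trans_le hq).ne'
  obtain ⟨U, hU, V, hV, s, hs, rfl⟩ := exists_svd Y
  have hz0 : 0 ≤ (b⁻¹).toReal := ENNReal.toReal_nonneg
  obtain ⟨α, d, hα, hα1, hd, hsd, hdN⟩ : ∃ α d : k → ℝ, (∀ i, 0 ≤ α i) ∧ ∑ i, α i ≤ 1 ∧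
      (∀ i, 0 ≤ d i) ∧ (∀ i, s i = α i ^ (b⁻¹).toReal * d i * α i ^ (b⁻¹).toReal) ∧
      vecNorm p d ≤ vecNorm q s := by
    by_cases hqt : q = ⊤
    · subst hqt
      obtain rfl : p = ⊤ := top_le_iff.mp hle
      have hz : (b⁻¹).toReal = 0 := by linarith
      exact ⟨0, s, by simp, by simp, hs, by simp [hz], le_rfl⟩
    · obtain ⟨α, hα, hα1, -, hsα⟩ := exists_eq_vecNorm_mul_rpow hqt hq0 hs
      have hN := vecNorm_nonneg q hs
      have hd : ∀ i, 0 ≤ vecNorm q s * α i ^ (p⁻¹).toReal :=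
        fun i => mul_nonneg hN (Real.rpow_nonneg (hα i) _)
      refine ⟨α, _, hα, hα1, hd, fun i => ?_,
        vecNorm_le_of_le_mul_rpow hp0 hd hα hα1 hN fun i => le_rfl⟩
      have : α i ^ (q⁻¹).toReal = α i ^ (b⁻¹).toReal * α i ^ (p⁻¹).toReal *
          α i ^ (b⁻¹).toReal := by
        rw [← Real.rpow_add_of_nonneg (hα i) hz0 ENNReal.toReal_nonneg,
          ← Real.rpow_add_of_nonneg (hα i) (add_nonneg hz0 ENNReal.toReal_nonneg) hz0]
        congr 1
        linarith
      rw [hsα i, this]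
      ring
  have hαz : ∀ i, 0 ≤ α i ^ (b⁻¹).toReal := fun i => Real.rpow_nonneg (hα i) _
  refine ⟨U * diagonal (fun i => ((α i ^ (b⁻¹).toReal : ℝ) : ℂ)) * 1,
    1 * diagonal (fun i => (d i : ℂ)) * 1,
    1 * diagonal (fun i => ((α i ^ (b⁻¹).toReal : ℝ) : ℂ)) * V, ?_,
    schattenNorm_le_of_le_mul_rpow hb hU (one_mem _) hαz hα hα1 zero_le_one
      (fun i => (one_mul _).ge),
    schattenNorm_le_of_le_mul_rpow hb (one_mem _) hV hαz hα hα1 zero_le_one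
      (fun i => (one_mul _).ge), ?_⟩
  · have : diagonal (fun i => (s i : ℂ)) = diagonal (fun i => ((α i ^ (b⁻¹).toReal : ℝ) : ℂ)) *
        diagonal (fun i => (d i : ℂ)) * diagonal (fun i => ((α i ^ (b⁻¹).toReal : ℝ) : ℂ)) := by
      rw [diagonal_mul_diagonal, diagonal_mul_diagonal]
      congr 1
      ext i
      rw [hsd i]
      push_cast
      rfl
    rw [this]
    simp only [one_mul, mul_one, mul_assoc]
  · rwa [schattenNorm_svd p (one_mem _) (one_mem _) hd, schattenNorm_svd q hU hV hs]

theorem ncNormSup_kronecker {k l : Type*} [Fintype k] [DecidableEq k] [Fintype l] [DecidableEq l]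
    {p q : ℝ≥0∞} (hp : 1 ≤ p) (hq : 1 ≤ q) (hpq : p ≤ q) (Y₁ : Matrix k k ℂ)
    (Y₂ : Matrix l l ℂ) :
    ncNormSup p q (Y₁ ⊗ₖ Y₂) = schattenNorm q Y₁ * schattenNorm p Y₂ := by
  have hb : 2 * ncR p q ≠ 0 := ncR_ne_zero hp hq
  have hexp := two_mul_toReal_inv_two_mul_ncR hp hpq
  have hq0 : q ≠ 0 := (zero_lt_one.trans_le hq).ne'
  simp only [ncNormSup, kronecker_one_mul_kronecker_mul, schattenNorm_kronecker]
  set b := 2 * ncR p q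
  have hN : 0 ≤ schattenNorm q Y₁ * schattenNorm p Y₂ :=
    mul_nonneg (schattenNorm_nonneg _ _) (schattenNorm_nonneg _ _)
  have hHolder : ∀ A B : Matrix k k ℂ, schattenNorm p (A * Y₁ * B) ≤
      schattenNorm b A * schattenNorm q Y₁ * schattenNorm b B :=
    fun A B => schattenNorm_mul_mul_le hp hb hq0 (by linarith) A Y₁ B
  have hterm : ∀ A B : Matrix k k ℂ, schattenNorm p (A * Y₁ * B) * schattenNorm p Y₂ /
      (schattenNorm b A * schattenNorm b B) ≤ schattenNorm q Y₁ * schattenNorm p Y₂ := by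
    intro A B
    refine div_le_of_le_mul₀ (mul_nonneg (schattenNorm_nonneg _ _) (schattenNorm_nonneg _ _)) hN ?_
    refine (mul_le_mul_of_nonneg_right (hHolder A B) (schattenNorm_nonneg p Y₂)).trans_eq ?_
    ring
  have hinner : ∀ A : Matrix k k ℂ, ⨆ B : Matrix k k ℂ, schattenNorm p (A * Y₁ * B) *
      schattenNorm p Y₂ / (schattenNorm b A * schattenNorm b B) ≤
      schattenNorm q Y₁ * schattenNorm p Y₂ := fun A => Real.iSup_le (hterm A) hN
  refine le_antisymm (Real.iSup_le hinner hN) ?_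
  obtain ⟨A, B, hA, hB, hAB⟩ := exists_schattenNorm_le_schattenNorm_mul_mul hp hq hb hexp Y₁
  refine le_ciSup_of_le ⟨_, Set.forall_mem_range.mpr hinner⟩ A
    (le_ciSup_of_le ⟨_, Set.forall_mem_range.mpr (hterm A)⟩ B ?_)
  have hA0 := schattenNorm_nonneg b A
  have hB0 := schattenNorm_nonneg b B
  have hY₁ := schattenNorm_nonneg q Y₁
  have hY₂ := schattenNorm_nonneg p Y₂
  rcases (mul_nonneg hA0 hB0).eq_or_lt with h0 | h0
  · have := hHolder A B
    rw [mul_right_comm, ← h0, zero_mul] at this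
    rw [le_antisymm (hAB.trans this) hY₁, ← h0, zero_mul, div_zero]
  · rw [le_div_iff₀ h0]
    calc schattenNorm q Y₁ * schattenNorm p Y₂ * (schattenNorm b A * schattenNorm b B)
        ≤ schattenNorm q Y₁ * schattenNorm p Y₂ :=
          mul_le_of_le_one_right hN (mul_le_one₀ hA hB0 hB)
      _ ≤ _ := mul_le_mul_of_nonneg_right hAB hY₂

theorem ncNormInf_kronecker {k l : Type*} [Fintype k] [DecidableEq k] [Fintype l] [DecidableEq l]
    {p q : ℝ≥0∞} (hp : 1 ≤ p) (hq : 1 ≤ q) (hqp : q ≤ p) (Y₁ : Matrix k k ℂ)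
    (Y₂ : Matrix l l ℂ) :
    ncNormInf p q (Y₁ ⊗ₖ Y₂) = schattenNorm q Y₁ * schattenNorm p Y₂ := by
  have hb : 2 * ncR p q ≠ 0 := ncR_ne_zero hp hq
  have hexp : 2 * ((2 * ncR p q)⁻¹).toReal = (q⁻¹).toReal - (p⁻¹).toReal := by
    rw [ncR_comm]
    exact two_mul_toReal_inv_two_mul_ncR hq hqp
  unfold ncNormInf
  set b := 2 * ncR p q
  have hY₁ := schattenNorm_nonneg q Y₁
  have hY₂ := schattenNorm_nonneg p Y₂
  obtain ⟨A, X, B, hY, hA, hB, hX⟩ := exists_eq_mul_mul_schattenNorm_le hp hq hb hqp hexp Y₁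
  have hmem : schattenNorm b A * schattenNorm b B * schattenNorm p (X ⊗ₖ Y₂) ∈
      { s : ℝ | ∃ (N : ℕ) (A B : Fin N → Matrix k k ℂ) (Z : Fin N → Matrix (k × l) (k × l) ℂ),
        Y₁ ⊗ₖ Y₂ = ∑ i, (A i ⊗ₖ (1 : Matrix l l ℂ)) * Z i * (B i ⊗ₖ (1 : Matrix l l ℂ)) ∧
        s = ∑ i, schattenNorm b (A i) * schattenNorm b (B i) * schattenNorm p (Z i) } := by
    refine ⟨1, fun _ => A, fun _ => B, fun _ => X ⊗ₖ Y₂, ?_, by simp⟩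
    rw [Fin.sum_univ_one, kronecker_one_mul_kronecker_mul, ← hY]
  have hlower : ∀ s ∈ { s : ℝ | ∃ (N : ℕ) (A B : Fin N → Matrix k k ℂ)
      (Z : Fin N → Matrix (k × l) (k × l) ℂ),
        Y₁ ⊗ₖ Y₂ = ∑ i, (A i ⊗ₖ (1 : Matrix l l ℂ)) * Z i * (B i ⊗ₖ (1 : Matrix l l ℂ)) ∧
        s = ∑ i, schattenNorm b (A i) * schattenNorm b (B i) * schattenNorm p (Z i) },
      schattenNorm q Y₁ * schattenNorm p Y₂ ≤ s := by
    rintro s ⟨N, A, B, Z, hZ, rfl⟩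
    obtain ⟨p', hp', hpp⟩ := exists_dual_exponent hp
    obtain ⟨q', hq', hqq⟩ := exists_dual_exponent hq
    obtain ⟨W₁, hW₁, htr₁⟩ := exists_trace_mul_eq_schattenNorm hq hq' hqq Y₁
    obtain ⟨W₂, hW₂, htr₂⟩ := exists_trace_mul_eq_schattenNorm hp hp' hpp Y₂
    have htr : ((schattenNorm q Y₁ * schattenNorm p Y₂ : ℝ) : ℂ) =
        ∑ i, trace (((B i * W₁ * A i) ⊗ₖ W₂) * Z i) := by
      push_cast
      rw [← htr₁, ← htr₂, ← trace_kronecker, mul_kronecker_mul, hZ, Finset.mul_sum, trace_sum]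
      refine Finset.sum_congr rfl fun i _ => ?_
      rw [← kronecker_one_mul_kronecker_mul, ← mul_assoc, trace_mul_comm]
      simp only [mul_assoc]
    have hterm : ∀ i, ‖trace (((B i * W₁ * A i) ⊗ₖ W₂) * Z i)‖ ≤
        schattenNorm b (A i) * schattenNorm b (B i) * schattenNorm p (Z i) := by
      intro i
      have hA0 := schattenNorm_nonneg b (A i)
      have hB0 := schattenNorm_nonneg b (B i)
      have hZ0 := schattenNorm_nonneg p (Z i)
      have h1 := schattenNorm_nonneg p' W₂
      have h2 : schattenNorm p' (B i * W₁ * A i) ≤ schattenNorm b (B i) * schattenNorm q' W₁ *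
          schattenNorm b (A i) :=
        schattenNorm_mul_mul_le hp' hb (zero_lt_one.trans_le hq').ne' (by linarith) _ _ _
      calc _ ≤ schattenNorm p' ((B i * W₁ * A i) ⊗ₖ W₂) * schattenNorm p (Z i) :=
            norm_trace_mul_le hp hp' hpp _ _
        _ = schattenNorm p' (B i * W₁ * A i) * schattenNorm p' W₂ * schattenNorm p (Z i) := by
            rw [schattenNorm_kronecker]
        _ ≤ schattenNorm b (B i) * 1 * schattenNorm b (A i) * 1 * schattenNorm p (Z i) := by
            have h3 := h2.trans (mul_le_mul_of_nonneg_right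
              (mul_le_mul_of_nonneg_left hW₁ hB0) hA0)
            gcongr
        _ = _ := by ring
    calc schattenNorm q Y₁ * schattenNorm p Y₂
        = ‖((schattenNorm q Y₁ * schattenNorm p Y₂ : ℝ) : ℂ)‖ := by
          rw [Complex.norm_real, Real.norm_of_nonneg (mul_nonneg hY₁ hY₂)]
      _ ≤ _ := by
          rw [htr]
          exact norm_sum_le_of_le _ fun i _ => hterm i
  refine le_antisymm ?_ (le_csInf ⟨_, hmem⟩ hlower)
  refine (csInf_le ⟨_, hlower⟩ hmem).trans ?_
  have hX0 := schattenNorm_nonneg p X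
  rw [schattenNorm_kronecker]
  calc schattenNorm b A * schattenNorm b B * (schattenNorm p X * schattenNorm p Y₂)
      ≤ schattenNorm p X * schattenNorm p Y₂ :=
        mul_le_of_le_one_left (mul_nonneg hX0 hY₂) (mul_le_one₀ hA (schattenNorm_nonneg b B) hB)
    _ ≤ _ := mul_le_mul_of_nonneg_right hX hY₂

/-- **Product form of the NC norm on product matrices.** -/
theorem ncNorm_kronecker {n m : ℕ} (hn : 0 < n) (hm : 0 < m) (p q : ℝ≥0∞)
    (hp : 1 ≤ p) (hq : 1 ≤ q)
    (Y₁ : Matrix (Fin n) (Fin n) ℂ) (Y₂ : Matrix (Fin m) (Fin m) ℂ) :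
    ncNorm p q (Y₁ ⊗ₖ Y₂) = schattenNorm q Y₁ * schattenNorm p Y₂ := by
  unfold ncNorm
  split_ifs with h
  · exact ncNormSup_kronecker hp hq h Y₁ Y₂
  · exact ncNormInf_kronecker hp hq (not_le.mp h).le Y₁ Y₂
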